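/- Let d = 1, p = 1, and let q ≥ 2 be an integer, n = 1 + q. Then: (a) for every odd positive integer m₀ there exists μ ∈ Λ⁺(B) such that |η_μ(λ)| → ∞ as λ → −m₀ (along the punctured neighborhood of −m₀ intersected with the domain of η_μ); and (b) for every real λ₀ that is not an odd negative integer and every μ ∈ Λ⁺(B), the function η_μ has a finite limit at λ₀. (That is, in the case p = 1, d = 1—the cosine-λ transform on real projective space—the poles occur exactly at the odd negative integers.) -/

import Mathlib

open Filter Set

/-- `x` is a nonpositive integer (a pole of the Gamma function). -/
def IsNonposInt (x : ℝ) : Prop := ∃ k : ℕ, x = -(k : ℝ)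

/-- The eigenvalue `η_μ(λ)` of the cosine-λ transform on `Gr(p, 𝕂^{p+q})`
(`d = dim_ℝ 𝕂`) on the K-type of highest weight `μ = m`. -/
noncomputable def eta (d p q : ℕ) (m : Fin p → ℤ) (l : ℝ) : ℝ :=
  (-1 : ℝ) ^ ((∑ j, m j) / 2) *
    ((∏ j : Fin p,
        Real.Gamma ((d : ℝ) * ((p : ℝ) + (q : ℝ)) / 2 - (d : ℝ) * ((j : ℕ) : ℝ) / 2)) /
      (∏ j : Fin p, Real.Gamma ((d : ℝ) * (p : ℝ) / 2 - (d : ℝ) * ((j : ℕ) : ℝ) / 2))) *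
    (∏ j : Fin p,
      Real.Gamma ((d : ℝ) * (l + (p : ℝ)) / 2 - (d : ℝ) * ((j : ℕ) : ℝ) / 2) *
        Real.Gamma ((-(d : ℝ) * l + (m j : ℝ)) / 2 - (d : ℝ) * ((j : ℕ) : ℝ) / 2)) /
    (∏ j : Fin p,
      Real.Gamma (-(d : ℝ) * l / 2 - (d : ℝ) * ((j : ℕ) : ℝ) / 2) *
        Real.Gamma
          (((d : ℝ) * l + (d : ℝ) * ((p : ℝ) + (q : ℝ)) + (m j : ℝ)) / 2 -
            (d : ℝ) * ((j : ℕ) : ℝ) / 2))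

/-- Domain of `η_μ`: the set of real `λ` at which no Gamma argument appearing in the
formula for `η_μ(λ)` is a nonpositive integer. -/
def etaDom (d p q : ℕ) (m : Fin p → ℤ) : Set ℝ :=
  {l | ∀ j : Fin p,
    ¬ IsNonposInt ((d : ℝ) * (l + (p : ℝ)) / 2 - (d : ℝ) * ((j : ℕ) : ℝ) / 2) ∧
    ¬ IsNonposInt ((-(d : ℝ) * l + (m j : ℝ)) / 2 - (d : ℝ) * ((j : ℕ) : ℝ) / 2) ∧
    ¬ IsNonposInt (-(d : ℝ) * l / 2 - (d : ℝ) * ((j : ℕ) : ℝ) / 2) ∧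
    ¬ IsNonposInt
        (((d : ℝ) * l + (d : ℝ) * ((p : ℝ) + (q : ℝ)) + (m j : ℝ)) / 2 -
          (d : ℝ) * ((j : ℕ) : ℝ) / 2)}

/-- Membership in `Λ⁺(B)`: all `m_i` even, `m₁ ≥ m₂ ≥ ⋯ ≥ m_{p-1} ≥ |m_p|`, and
`m_p ≥ 0` unless `d = 1` and `p = q`. -/
def LambdaPlus (d p q : ℕ) (m : Fin p → ℤ) : Prop :=
  (∀ i, 2 ∣ m i) ∧ (∀ i j : Fin p, i < j → |m j| ≤ m i) ∧
    (¬(d = 1 ∧ p = q) → ∀ i, 0 ≤ m i)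

/-- The reciprocal of the real Gamma function is continuous. -/
theorem continuous_inv_Gamma : Continuous fun x : ℝ => (Real.Gamma x)⁻¹ := by
  have h : Continuous fun x : ℝ => ((Complex.Gamma (x : ℂ))⁻¹).re :=
    Complex.continuous_re.comp
      (Complex.differentiable_one_div_Gamma.continuous.comp Complex.continuous_ofReal)
  refine h.congr fun x => ?_
  rw [Complex.Gamma_ofReal, ← Complex.ofReal_inv, Complex.ofReal_re]

theorem Gamma_ne_zero_of_not_isNonposInt {x : ℝ} (hx : ¬ IsNonposInt x) : Real.Gamma x ≠ 0 :=
  Real.Gamma_ne_zero fun k hk => hx ⟨k, hk⟩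

/-- The rising factorial as a ratio of Gamma values. -/
theorem Gamma_add_nat_eq_mul_prod {x : ℝ} (hx : ¬ IsNonposInt x) (k : ℕ) :
    Real.Gamma (x + k) = Real.Gamma x * ∏ i ∈ Finset.range k, (x + i) := by
  induction k with
  | zero => simp
  | succ k ih =>
    have h : x + k ≠ 0 := fun h => hx ⟨k, by linarith⟩
    rw [Finset.prod_range_succ, Nat.cast_succ, ← add_assoc, Real.Gamma_add_one h, ih]
    ring

/-- For `p = d = 1` and `m = 2k`, the factor of `η_μ` other than `Γ((λ + 1)/2)`, with its
removable singularities removed. -/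
noncomputable def etaRegular (q k : ℕ) (l : ℝ) : ℝ :=
  (-1 : ℝ) ^ k * (Real.Gamma ((1 + q) / 2) / Real.Gamma (1 / 2)) *
    (∏ i ∈ Finset.range k, (-l / 2 + i)) * (Real.Gamma ((l + (1 + q) + 2 * k) / 2))⁻¹

theorem continuous_etaRegular (q k : ℕ) : Continuous (etaRegular q k) := by
  have h : Continuous fun l : ℝ => (Real.Gamma ((l + (1 + q) + 2 * k) / 2))⁻¹ :=
    continuous_inv_Gamma.comp (by fun_prop)
  unfold etaRegular
  fun_prop

theorem eta_eq_Gamma_mul_etaRegular {q k : ℕ} {m : Fin 1 → ℤ} (hm : m 0 = 2 * k) {l : ℝ}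
    (hl : l ∈ etaDom 1 1 q m) :
    eta 1 1 q m l = Real.Gamma ((l + 1) / 2) * etaRegular q k l := by
  have h := (hl 0).2.2.1
  simp only [Nat.cast_one, Fin.val_zero, Nat.cast_zero, mul_zero, zero_div, sub_zero, neg_mul,
    one_mul] at h
  have hG := Gamma_ne_zero_of_not_isNonposInt h
  have hk : Real.Gamma ((-l + 2 * k) / 2) =
      Real.Gamma (-l / 2) * ∏ i ∈ Finset.range k, (-l / 2 + i) := by
    rw [← Gamma_add_nat_eq_mul_prod h]
    congr 1
    ring
  simp only [eta, etaRegular, Fin.prod_univ_one, Fin.sum_univ_one, hm, Nat.cast_one, Fin.val_zero,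
    Nat.cast_zero, zero_div, sub_zero, neg_mul, one_mul, Int.cast_mul, Int.cast_ofNat,
    Int.cast_natCast, hk, ne_eq, OfNat.ofNat_ne_zero, not_false_eq_true,
    Int.mul_ediv_cancel_left, zpow_natCast]
  generalize Real.Gamma (-l / 2) = G at hG ⊢
  field_simp

theorem eta_eventuallyEq {q k : ℕ} {m : Fin 1 → ℤ} (hm : m 0 = 2 * k) (l₀ : ℝ) :
    (fun l => Real.Gamma ((l + 1) / 2) * etaRegular q k l)
      =ᶠ[nhdsWithin l₀ (etaDom 1 1 q m \ {l₀})] eta 1 1 q m :=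
  eventually_nhdsWithin_of_forall fun _ hl => (eta_eq_Gamma_mul_etaRegular hm hl.1).symm

theorem abs_etaRegular_neg_pos {q k : ℕ} (hk : 0 < k) : 0 < |etaRegular q k (-(k : ℝ))| := by
  have hk' : (0 : ℝ) < k := Nat.cast_pos.2 hk
  have h₁ : Real.Gamma ((1 + q) / 2) ≠ 0 := (Real.Gamma_pos_of_pos (by positivity)).ne'
  have h₂ : Real.Gamma (1 / 2) ≠ 0 := (Real.Gamma_pos_of_pos (by norm_num)).ne'
  have h₃ : Real.Gamma ((-(k : ℝ) + (1 + q) + 2 * k) / 2) ≠ 0 :=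
    (Real.Gamma_pos_of_pos (by
      rw [show -(k : ℝ) + (1 + q) + 2 * k = 1 + q + k by ring]
      positivity)).ne'
  have h₄ : ∏ i ∈ Finset.range k, (-(-(k : ℝ)) / 2 + i) ≠ 0 :=
    (Finset.prod_pos fun i _ => by rw [neg_neg]; positivity).ne'
  exact abs_pos.2 (mul_ne_zero (mul_ne_zero (mul_ne_zero (by simp) (div_ne_zero h₁ h₂)) h₄)
    (inv_ne_zero h₃))

theorem tendsto_abs_Gamma_atTop {α : Type*} {F : Filter α} {f : α → ℝ} {x : ℝ}
    (hx : IsNonposInt x) (hf : Tendsto f F (nhds x)) (h : ∀ᶠ a in F, ¬ IsNonposInt (f a)) :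
    Tendsto (fun a => |Real.Gamma (f a)|) F atTop := by
  have h₀ : (Real.Gamma x)⁻¹ = 0 := by
    obtain ⟨n, rfl⟩ := hx
    rw [Real.Gamma_neg_nat_eq_zero, inv_zero]
  have h₁ : Tendsto (fun a => |(Real.Gamma (f a))⁻¹|) F (nhds 0) := by
    have := ((continuous_inv_Gamma.tendsto x).comp hf).abs
    rwa [h₀, abs_zero] at this
  have h₂ : Tendsto (fun a => |(Real.Gamma (f a))⁻¹|) F (nhdsWithin 0 (Ioi 0)) :=
    tendsto_nhdsWithin_iff.2 ⟨h₁, h.mono fun a ha =>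
      abs_pos.2 (inv_ne_zero (Gamma_ne_zero_of_not_isNonposInt ha))⟩
  refine h₂.inv_tendsto_nhdsGT_zero.congr fun a => ?_
  simp [abs_inv]

/-- for p = 1, d = 1 (the cosine-λ transform on real projective space),
the poles occur exactly at the odd negative integers. -/
theorem poles_projective_space_case
    (q : ℕ) (hq : 2 ≤ q) :
    (∀ m₀ : ℕ, Odd m₀ →
      ∃ m : Fin 1 → ℤ, LambdaPlus 1 1 q m ∧
        Tendsto (fun l : ℝ => |eta 1 1 q m l|)
          (nhdsWithin (-(m₀ : ℝ)) (etaDom 1 1 q m \ {-(m₀ : ℝ)})) atTop) ∧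
    (∀ l₀ : ℝ, (¬ ∃ k : ℕ, Odd k ∧ l₀ = -(k : ℝ)) →
      ∀ m : Fin 1 → ℤ, LambdaPlus 1 1 q m →
        ∃ c : ℝ, Tendsto (eta 1 1 q m)
          (nhdsWithin l₀ (etaDom 1 1 q m \ {l₀})) (nhds c)) := by
  refine ⟨fun m₀ hm₀ => ?_, fun l₀ hl₀ m hm => ?_⟩
  · refine ⟨fun _ => 2 * m₀, ⟨fun _ => dvd_mul_right _ _, fun i j hij => ?_,
      fun _ _ => by positivity⟩, ?_⟩
    · exact absurd hij (by simp [Subsingleton.elim i j])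
    have hΓ : Tendsto (fun l : ℝ => |Real.Gamma ((l + 1) / 2)|)
        (nhdsWithin (-(m₀ : ℝ)) (etaDom 1 1 q (fun _ => 2 * m₀) \ {-(m₀ : ℝ)})) atTop := by
      refine tendsto_abs_Gamma_atTop (x := (-(m₀ : ℝ) + 1) / 2) ?_ ?_ ?_
      · obtain ⟨r, rfl⟩ := hm₀
        exact ⟨r, by push_cast; ring⟩
      · exact (Continuous.tendsto (by fun_prop) _).mono_left nhdsWithin_le_nhds
      · exact eventually_nhdsWithin_of_forall fun l hl => by simpa using (hl.1 0).1
    have hR := ((continuous_etaRegular q m₀).tendsto (-(m₀ : ℝ))).abs.mono_left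
      (nhdsWithin_le_nhds (s := etaDom 1 1 q (fun _ => 2 * m₀) \ {-(m₀ : ℝ)}))
    refine (hΓ.atTop_mul_pos (abs_etaRegular_neg_pos hm₀.pos) hR).congr' ?_
    filter_upwards [eta_eventuallyEq (q := q) (m := fun _ => 2 * m₀) rfl (-(m₀ : ℝ))] with l hl
    rw [← hl, abs_mul]
  · obtain ⟨k, hk⟩ : ∃ k : ℕ, m 0 = 2 * k := by
      have h₀ := hm.2.2 (by omega) 0
      obtain ⟨a, ha⟩ := hm.1 0
      exact ⟨a.toNat, by omega⟩
    have hx : ∀ r : ℕ, (l₀ + 1) / 2 ≠ -(r : ℝ) := fun r hr =>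
      hl₀ ⟨2 * r + 1, odd_two_mul_add_one r, by push_cast; linarith⟩
    have hΓ : ContinuousAt (fun l : ℝ => Real.Gamma ((l + 1) / 2)) l₀ :=
      ContinuousAt.comp (f := fun l : ℝ => (l + 1) / 2)
        (Real.differentiableAt_Gamma hx).continuousAt (by fun_prop)
    exact ⟨_, ((hΓ.mul (continuous_etaRegular q k).continuousAt).tendsto.mono_left
      nhdsWithin_le_nhds).congr' (eta_eventuallyEq hk l₀)⟩
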